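/- For every k ≥ 1, the shift s_k := (T^{π^k})^m v^{k−1} − v^{π^k} satisfies the identity s_k = γ^m P_{π^k}^m (I − γ P_{π^k})^{−1} b_{k−1}, where b_{k−1} := v^{k−1} − T^{π^k} v^{k−1}; here I − γ P_{π^k} is invertible since γ < 1 and P_{π^k} is a stochastic matrix, and (I − γ P_{π^k})^{−1} = Σ_{j=0}^∞ γ^j P_{π^k}^j. -/

import Mathlib

section LinftyOpNorm

attribute [local instance] Matrix.linftyOpNormedRing Matrix.linftyOpNormedAlgebra

/-- A square real matrix with nonnegative entries and unit row sums, scaled by `γ ∈ [0, 1)`,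
has `ℓ∞` operator norm less than one. -/
theorem Matrix.linfty_opNorm_smul_lt_one_of_stochastic {S : Type*} [Fintype S] [DecidableEq S]
    {γ : ℝ} (hγ0 : 0 ≤ γ) (hγ1 : γ < 1) {A : Matrix S S ℝ}
    (hA : ∀ s, (∀ s', 0 ≤ A s s') ∧ ∑ s', A s s' = 1) : ‖γ • A‖ < 1 := by
  have hle : ‖A‖₊ ≤ 1 := by
    rw [Matrix.linfty_opNNNorm_def]
    refine Finset.sup_le fun s _ => ?_
    rw [← NNReal.coe_le_coe]
    push_cast
    simp only [Real.norm_of_nonneg ((hA s).1 _), (hA s).2, le_refl]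
  rw [norm_smul, Real.norm_of_nonneg hγ0]
  exact (mul_le_of_le_one_right hγ0 (by exact_mod_cast hle)).trans_lt hγ1

/-- The resolvent of a stochastic matrix at a discount factor `γ ∈ [0, 1)` exists and is given by
its Neumann series. -/
theorem Matrix.isUnit_one_sub_smul_and_inv_eq_tsum_of_stochastic {S : Type*} [Fintype S]
    [DecidableEq S] {γ : ℝ} (hγ0 : 0 ≤ γ) (hγ1 : γ < 1) {A : Matrix S S ℝ}
    (hA : ∀ s, (∀ s', 0 ≤ A s s') ∧ ∑ s', A s s' = 1) :
    IsUnit (1 - γ • A) ∧ (1 - γ • A)⁻¹ = ∑' j : ℕ, γ ^ j • A ^ j := by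
  have hlt := Matrix.linfty_opNorm_smul_lt_one_of_stochastic hγ0 hγ1 hA
  refine ⟨isUnit_one_sub_of_norm_lt_one hlt, ?_⟩
  simp_rw [← smul_pow]
  rw [Matrix.nonsing_inv_eq_ringInverse]
  exact (geom_series_eq_inverse _ hlt).symm

end LinftyOpNorm

/-- Iterates of an affine map with linear part `M` differ by powers of `M`. -/
theorem Matrix.iterate_sub_iterate_of_affine {S R : Type*} [Fintype S] [DecidableEq S] [Ring R]
    {F : (S → R) → S → R} {M : Matrix S S R} (hF : ∀ v w, F v - F w = M.mulVec (v - w))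
    (n : ℕ) (v w : S → R) : F^[n] v - F^[n] w = (M ^ n).mulVec (v - w) := by
  induction n with
  | zero => simp
  | succ n ih =>
    rw [Function.iterate_succ_apply', Function.iterate_succ_apply', hF, ih, Matrix.mulVec_mulVec,
      ← pow_succ']


/-- Identity for the shift `s_k = (T^{π^k})^m v^{k−1} − v^{π^k}` in
approximate modified policy iteration:
`s_k = γ^m P_{π^k}^m (I − γ P_{π^k})⁻¹ b_{k−1}`, where `I − γ P_{π^k}` is
invertible (since `γ < 1`) and `(I − γ P_{π^k})⁻¹ = Σ_{j=0}^∞ γ^j P_{π^k}^j`. -/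
theorem ampi_shift_identity
    {S PI : Type*} [Fintype S] [Nonempty S] [DecidableEq S]
    (γ : ℝ) (hγ0 : 0 ≤ γ) (hγ1 : γ < 1)
    (P : PI → S → S → ℝ)
    (hP : ∀ π s, (∀ s', 0 ≤ P π s s') ∧ ∑ s', P π s s' = 1)
    (c : PI → S → ℝ)
    (T : PI → (S → ℝ) → (S → ℝ))
    (hT : ∀ π v s, T π v s = c π s + γ * ∑ s', P π s s' * v s')
    (vfix : PI → S → ℝ)
    (hfix : ∀ π, T π (vfix π) = vfix π)
    (m : ℕ) (hm : 1 ≤ m)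
    (πk : ℕ → PI) (vk : ℕ → S → ℝ) (eps eps' : ℕ → S → ℝ)
    (hgreedy : ∀ (k : ℕ) (π : PI) (s : S),
      T π (vk k) s ≤ T (πk (k + 1)) (vk k) s + eps' (k + 1) s)
    (heval : ∀ k : ℕ, vk (k + 1) = (T (πk (k + 1)))^[m] (vk k) + eps (k + 1)) :
    ∀ k, 1 ≤ k →
      IsUnit (1 - γ • Matrix.of (P (πk k))) ∧
      (1 - γ • Matrix.of (P (πk k)))⁻¹ = ∑' j : ℕ, γ ^ j • (Matrix.of (P (πk k))) ^ j ∧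
      (T (πk k))^[m] (vk (k - 1)) - vfix (πk k) =
        Matrix.mulVec
          (γ ^ m • ((Matrix.of (P (πk k))) ^ m * (1 - γ • Matrix.of (P (πk k)))⁻¹))
          (vk (k - 1) - T (πk k) (vk (k - 1))) := by
  intro k _
  obtain ⟨hunit, hinv⟩ :=
    Matrix.isUnit_one_sub_smul_and_inv_eq_tsum_of_stochastic hγ0 hγ1 (A := Matrix.of (P (πk k)))
      (hP (πk k))
  refine ⟨hunit, hinv, ?_⟩
  set A := Matrix.of (P (πk k)) with hA
  set v := vk (k - 1)
  have haff : ∀ v w, T (πk k) v - T (πk k) w = (γ • A).mulVec (v - w) := by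
    intro v w
    ext s
    simp [hT, hA, Matrix.mulVec, dotProduct, mul_sub, mul_assoc, Finset.mul_sum]
  have hres : v - T (πk k) v = (1 - γ • A).mulVec (v - vfix (πk k)) := by
    rw [Matrix.sub_mulVec, Matrix.one_mulVec, ← haff, hfix]
    abel
  have hdet := (Matrix.isUnit_iff_isUnit_det _).1 hunit
  rw [hres, Matrix.mulVec_mulVec, Matrix.smul_mul, Matrix.mul_assoc,
    Matrix.nonsing_inv_mul _ hdet, Matrix.mul_one, ← smul_pow,
    ← Matrix.iterate_sub_iterate_of_affine haff, Function.iterate_fixed (hfix (πk k))]
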